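/- Let $K$ be an algebraically closed field of characteristic $0$ that is complete with respect to a non-trivial (possibly non-archimedean) absolute value $|\cdot|$, and let $f\in K(z)$ be a rational function of degree $d>1$. Write $\mathbb{N}=\{1,2,\dots\}$. Notation. Let $\|\cdot\|$ be the maximum norm on $K^2$ if $K$ is non-archimedean and the Euclidean norm $\sqrt{|p_0|^2+|p_1|^2}$ if $K$ is archimedean, let $\pi:K^2\setminus\{0\}\to\mathbb{P}^1=\mathbb{P}^1(K)$ be the canonical projection, and let $[\pi(p),\pi(q)]=|p_0q_1-p_1q_0|/(\|p\|\,\|q\|)\in[0,1]$ be the normalized chordal metric on $\mathbb{P}^1$. Let $\mathsf{P}^1$ be the Berkovich projective line over $K$ (equal to $\mathbb{P}^1$ if $K$ is archimedean), and let $[\cdot,\cdot]_{\mathrm{can}}$ be the generalized Hsia kernel on $\mathsf{P}^1$ with respect to the Gauss point, i.e. $[\mathcal{S},\mathcal{S}']_{\mathrm{can}}=\limsup_{\mathbb{P}^1\times\mathbb{P}^1\ni(z,w)\to(\mathcal{S},\mathcal{S}')}[z,w]$, which extends $[\cdot,\cdot]$. For a continuous function $g$ on $\mathsf{P}^1$ put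 $\Phi_g(\mathcal{S},\mathcal{S}')=\log[\mathcal{S},\mathcal{S}']_{\mathrm{can}}-g(\mathcal{S})-g(\mathcal{S}')$, and let $V_g$ be the supremum of $\int\!\!\int\Phi_g\,d\nu\,d\nu$ over all probability Radon measures $\nu$ on $\mathsf{P}^1$. Let $F:K^2\to K^2$ be a homogeneous polynomial map of degree $d$ with $F^{-1}(0)=\{0\}$ that lifts $f$, and let $g_F=\lim_{n\to\infty}d^{-n}T_{F^n}$, where $T_{F^n}$ is the continuous function on $\mathsf{P}^1$ with $T_{F^n}(\pi(p))=\log\|F^n(p)\|-d^n\log\|p\|$. The dynamical Green function of $f$ is $g_f=g_F+V_{g_F}/2$; it does not depend on $F$, and $V_{g_f}=0$. Let $\mathrm{Fix}(f^n)$ and $C(f^n)$ be the sets of the fixed points and of the critical points of $f^n$ in $\mathbb{P}^1$, let $\mathrm{SAT}(f)=\bigcup_{n\in\mathbb{N}}(\mathrm{Fix}(f^n)\cap C(f^n))$ be the set of superattracting periodic points of $f$, and let $[f^n=\mathrm{Id}]=\sum_{w\in\mathbb{P}^1:\,f^n(w)=w}\delta_w$ on $\mathsf{P}^1$, where each $w$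 is counted with its multiplicity as a root of $f^n=\mathrm{Id}$. Then $$\sup_{n\in\mathbb{N}}\ \sup_{c\in C(f^n)\cap\mathrm{Fix}(f^n)}\left|\int_{\mathrm{SAT}(f)\setminus\{c\}}\Phi_{g_f}(c,\cdot)\,d[f^n=\mathrm{Id}](\cdot)\right|\le\left(-\log\Bigl(\inf_{c,c'\in\mathrm{SAT}(f):\,c\ne c'}[c,c']\Bigr)+2\sup_{\mathsf{P}^1}|g_f|\right)\cdot\sup_{n\in\mathbb{N}}\bigl([f^n=\mathrm{Id}](\mathrm{SAT}(f))\bigr)<\infty.$$ Here the suprema of absolute values are taken in $[0,\infty]$, so that a supremum over the empty set is $0$, and the infimum is taken in $[0,1]$, so that it is $1$ if $\mathrm{SAT}(f)$ has at most one point. -/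

import Mathlib

open Filter Set Topology MeasureTheory
open scoped ENNReal LinearAlgebra.Projectivization

noncomputable section

namespace BerkDyn

variable {K : Type*} [NontriviallyNormedField K]

/-! ### The classical projective line and the normalized chordal metric -/

/-- The classical projective line `ℙ¹ = ℙ¹(K)`; the affine coordinate is `z = p₀ / p₁`. -/
abbrev P1 (K : Type*) [NontriviallyNormedField K] : Type _ := ℙ K (Fin 2 → K)

open Classical in
/-- The norm of a pair with absolute values `a, b`: the maximum norm for non-archimedean `K`,
the Euclidean norm for archimedean `K`. -/
def pairNorm (K : Type*) [NontriviallyNormedField K] (a b : ℝ) : ℝ :=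
  if IsUltrametricDist K then max a b else Real.sqrt (a ^ 2 + b ^ 2)

/-- The normalized chordal metric `[z, w] = |p ∧ q| / (‖p‖ ‖q‖)`, `z = π(p)`, `w = π(q)`.
(It does not depend on the representatives `p, q`.) -/
def chordal (z w : P1 K) : ℝ :=
  ‖z.rep 0 * w.rep 1 - z.rep 1 * w.rep 0‖ /
    (pairNorm K ‖z.rep 0‖ ‖z.rep 1‖ * pairNorm K ‖w.rep 0‖ ‖w.rep 1‖)

/-! ### The Berkovich projective line -/

/-- Multiplicative seminorms on `K[X₀, X₁]` that extend the absolute value of `K` and do not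
vanish at both `X₀` and `X₁`. -/
def Cone (K : Type*) [NontriviallyNormedField K] : Type _ :=
  {N : MulRingSeminorm (MvPolynomial (Fin 2) K) //
    (∀ a : K, N (MvPolynomial.C a) = ‖a‖) ∧ ∃ i, N (MvPolynomial.X i) ≠ 0}

/-- Two seminorms are equivalent if for some constant `C > 0` they differ by the factor `C ^ d`
on the homogeneous polynomials of degree `d`, for every `d`. -/
instance coneSetoid (K : Type*) [NontriviallyNormedField K] : Setoid (Cone K) where
  r M N := ∃ C : ℝ, 0 < C ∧ ∀ (d : ℕ) (G : MvPolynomial (Fin 2) K), G.IsHomogeneous d →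
    M.1 G = C ^ d * N.1 G
  iseqv :=
    { refl := fun M => ⟨1, one_pos, fun d G _ => by simp⟩
      symm := by
        rintro M N ⟨C, hC, h⟩
        refine ⟨C⁻¹, inv_pos.2 hC, fun d G hG => ?_⟩
        rw [h d G hG, ← mul_assoc, ← mul_pow, inv_mul_cancel₀ hC.ne', one_pow, one_mul]
      trans := by
        rintro M N L ⟨C, hC, h⟩ ⟨D, hD, h'⟩
        refine ⟨C * D, mul_pos hC hD, fun d G hG => ?_⟩
        rw [h d G hG, h' d G hG, mul_pow, mul_assoc] }

/-- The Berkovich projective line `𝖯¹ = 𝖯¹(K)` (the `Proj` construction). For archimedean `K`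
the only points are the classical ones. -/
def BerkP1 (K : Type*) [NontriviallyNormedField K] : Type _ := Quotient (coneSetoid K)

/-- A seminorm on `K[X₀, X₁]` representing the point `S`. -/
def BerkP1.seminorm (S : BerkP1 K) : MulRingSeminorm (MvPolynomial (Fin 2) K) :=
  (Quotient.out (s := coneSetoid K) S).1

/-- `‖(X₀, X₁)‖` at the chosen seminorm representing `S`. -/
def BerkP1.size (S : BerkP1 K) : ℝ :=
  pairNorm K (S.seminorm (MvPolynomial.X 0)) (S.seminorm (MvPolynomial.X 1))

/-- The coarsest topology for which `S ↦ |G|_S / ‖(X₀, X₁)‖_S ^ d` is continuous for every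
homogeneous polynomial `G` of every degree `d` (these functions do not depend on the chosen
seminorms). -/
instance : TopologicalSpace (BerkP1 K) :=
  ⨅ (d : ℕ) (G : MvPolynomial.homogeneousSubmodule (Fin 2) K d),
    TopologicalSpace.induced (fun S : BerkP1 K => S.seminorm G.1 / S.size ^ d) inferInstance

instance : MeasurableSpace (BerkP1 K) := borel _

instance : BorelSpace (BerkP1 K) := ⟨rfl⟩

/-- The seminorm `G ↦ |G(p)|`. -/
def evalSeminorm (p : Fin 2 → K) : MulRingSeminorm (MvPolynomial (Fin 2) K) where
  toFun G := ‖MvPolynomial.eval p G‖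
  map_zero' := by simp
  add_le' G H := by simpa using norm_add_le (MvPolynomial.eval p G) (MvPolynomial.eval p H)
  neg' G := by simp
  map_one' := by simp
  map_mul' G H := by simp

/-- The inclusion `ℙ¹ → 𝖯¹`, sending `π(p)` to the class of `G ↦ |G(p)|`. -/
def toBerk (z : P1 K) : BerkP1 K :=
  Quotient.mk (coneSetoid K) ⟨evalSeminorm z.rep, by
    refine ⟨fun a => ?_, ?_⟩
    · change ‖MvPolynomial.eval z.rep (MvPolynomial.C a)‖ = ‖a‖
      simp
    · obtain ⟨i, hi⟩ := Function.ne_iff.1 z.rep_nonzero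
      refine ⟨i, ?_⟩
      change ‖MvPolynomial.eval z.rep (MvPolynomial.X i)‖ ≠ 0
      simpa using hi⟩

/-- The generalized Hsia kernel `[S, S']_can` with respect to the canonical (Gauss) point: the
upper semicontinuous extension of the chordal metric from `ℙ¹ × ℙ¹` to `𝖯¹ × 𝖯¹`. For archimedean
`K` it is the chordal metric itself. -/
def hsia (S S' : BerkP1 K) : ℝ :=
  limsup (fun p : P1 K × P1 K => chordal p.1 p.2) (comap (Prod.map toBerk toBerk) (𝓝 (S, S')))

/-! ### Potential theory -/

/-- The integral, with values in `[-∞, ∞]`, of an extended real valued function whose positive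
part has finite integral. -/
def eintegral {X : Type*} [MeasurableSpace X] (ν : Measure X) (φ : X → EReal) : EReal :=
  ((∫⁻ x, (φ x).toENNReal ∂ν : ℝ≥0∞) : EReal) - ((∫⁻ x, (-φ x).toENNReal ∂ν : ℝ≥0∞) : EReal)

/-- The kernel `Φ_g(S, S') = log [S, S']_can - g(S) - g(S')`, with values in `[-∞, ∞)`. -/
def Phi (g : BerkP1 K → ℝ) (S S' : BerkP1 K) : EReal :=
  ENNReal.log (ENNReal.ofReal (hsia S S')) - (g S : EReal) - (g S' : EReal)

/-- The potential `U_{g,ν}(S) = ∫ Φ_g(S, ·) dν`. -/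
def potential (g : BerkP1 K → ℝ) (ν : Measure (BerkP1 K)) (S : BerkP1 K) : EReal :=
  eintegral ν (Phi g S)

/-- The energy `∫∫ Φ_g d(ν × ν)`. -/
def energy (g : BerkP1 K → ℝ) (ν : Measure (BerkP1 K)) : EReal :=
  eintegral ν (potential g ν)

/-- The equilibrium energy `V_g`: the supremum of the energies of all the probability Radon
measures on `𝖯¹`. -/
def eqEnergy (g : BerkP1 K → ℝ) : EReal :=
  ⨆ (ν : Measure (BerkP1 K)) (_ : IsProbabilityMeasure ν) (_ : ν.Regular), energy g ν

/-! ### Rational functions -/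

/-- The degree of a rational function. -/
def deg (f : RatFunc K) : ℕ := max f.num.natDegree f.denom.natDegree

/-- The homogenization `∑ aₖ X₀ᵏ X₁ᵈ⁻ᵏ` in degree `d` of `P = ∑ aₖ zᵏ`, where `deg P ≤ d`. -/
def homogenize (d : ℕ) (P : Polynomial K) : MvPolynomial (Fin 2) K :=
  ∑ k ∈ Finset.range (d + 1),
    MvPolynomial.C (P.coeff k) * MvPolynomial.X 0 ^ k * MvPolynomial.X 1 ^ (d - k)

/-- A non-degenerate homogeneous lift `F = (F₀, F₁)` of `f`. -/
def lift (f : RatFunc K) : Fin 2 → MvPolynomial (Fin 2) K :=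
  ![homogenize (deg f) f.num, homogenize (deg f) f.denom]

/-- The iterate `Fⁿ` of the lift `F`, a non-degenerate homogeneous lift of `fⁿ`. -/
def liftIter (f : RatFunc K) : ℕ → Fin 2 → MvPolynomial (Fin 2) K
  | 0 => MvPolynomial.X
  | n + 1 => fun i => MvPolynomial.bind₁ (liftIter f n) (lift f i)

theorem eval_homogenize (d : ℕ) (P : Polynomial K) (p : Fin 2 → K) :
    MvPolynomial.eval p (homogenize d P) =
      ∑ k ∈ Finset.range (d + 1), P.coeff k * p 0 ^ k * p 1 ^ (d - k) := by
  simp [homogenize]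

theorem eval_homogenize_smul (d : ℕ) (P : Polynomial K) (t : K) (p : Fin 2 → K) :
    MvPolynomial.eval (t • p) (homogenize d P) = t ^ d * MvPolynomial.eval p (homogenize d P) := by
  rw [eval_homogenize, eval_homogenize, Finset.mul_sum]
  refine Finset.sum_congr rfl fun k hk => ?_
  have hk' : k + (d - k) = d := by have := Finset.mem_range.1 hk; omega
  conv_rhs => rw [← hk', pow_add]
  simp only [Pi.smul_apply, smul_eq_mul, mul_pow, hk']
  ring

theorem eval_homogenize_of_ne (d : ℕ) (P : Polynomial K) (hP : P.natDegree ≤ d) (p : Fin 2 → K)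
    (hp : p 1 ≠ 0) :
    MvPolynomial.eval p (homogenize d P) = p 1 ^ d * P.eval (p 0 / p 1) := by
  rw [eval_homogenize, Polynomial.eval_eq_sum_range' (Nat.lt_succ_of_le hP), Finset.mul_sum]
  refine Finset.sum_congr rfl fun k hk => ?_
  have hk' : (d - k) + k = d := by have := Finset.mem_range.1 hk; omega
  conv_rhs => rw [← hk', pow_add]
  simp only [div_pow]
  field_simp

theorem eval_homogenize_of_eq (d : ℕ) (P : Polynomial K) (p : Fin 2 → K) (hp : p 1 = 0) :
    MvPolynomial.eval p (homogenize d P) = P.coeff d * p 0 ^ d := by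
  rw [eval_homogenize, Finset.sum_eq_single d]
  · simp
  · intro k hk hkd
    have : d - k ≠ 0 := by have := Finset.mem_range.1 hk; omega
    simp [hp, this]
  · simp

theorem eval_lift_ne_zero (f : RatFunc K) (p : Fin 2 → K) (hp : p ≠ 0) :
    (fun i => MvPolynomial.eval p (lift f i)) ≠ 0 := by
  intro h
  have h0 : MvPolynomial.eval p (homogenize (deg f) f.num) = 0 := by
    simpa [lift] using congrFun h 0
  have h1 : MvPolynomial.eval p (homogenize (deg f) f.denom) = 0 := by
    simpa [lift] using congrFun h 1
  by_cases hp1 : p 1 = 0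
  · have hp0 : p 0 ≠ 0 := by
      intro hp0
      apply hp
      ext i
      fin_cases i
      · exact hp0
      · exact hp1
    rw [eval_homogenize_of_eq _ _ _ hp1] at h0 h1
    have c0 : f.num.coeff (deg f) = 0 := by simpa [hp0] using h0
    have c1 : f.denom.coeff (deg f) = 0 := by simpa [hp0] using h1
    rcases le_total f.num.natDegree f.denom.natDegree with hle | hle
    · rw [deg, max_eq_right hle] at c1
      exact f.denom_ne_zero (Polynomial.leadingCoeff_eq_zero.1 c1)
    · rw [deg, max_eq_left hle] at c0 c1
      have hnum := Polynomial.leadingCoeff_eq_zero.1 c0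
      rw [hnum, Polynomial.natDegree_zero] at hle
      rw [hnum, Polynomial.natDegree_zero, ← Nat.le_zero.1 hle] at c1
      exact f.denom_ne_zero (Polynomial.leadingCoeff_eq_zero.1 c1)
  · rw [eval_homogenize_of_ne (deg f) f.num (le_max_left _ _) _ hp1] at h0
    rw [eval_homogenize_of_ne (deg f) f.denom (le_max_right _ _) _ hp1] at h1
    have e0 : f.num.eval (p 0 / p 1) = 0 := by simpa [hp1] using h0
    have e1 : f.denom.eval (p 0 / p 1) = 0 := by simpa [hp1] using h1
    obtain ⟨a, b, hab⟩ := f.isCoprime_num_denom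
    have := congrArg (Polynomial.eval (p 0 / p 1)) hab
    simp [e0, e1] at this

/-- The map `ℙ¹ → ℙ¹` induced by `f`: `π(p) ↦ π(F(p))`. -/
def ratMap (f : RatFunc K) : P1 K → P1 K :=
  Projectivization.lift
    (fun v => Projectivization.mk K (fun i => MvPolynomial.eval v.1 (lift f i))
      (eval_lift_ne_zero f v.1 v.2)) (by
    rintro ⟨a, ha⟩ ⟨b, hb⟩ t (rfl : a = t • b)
    refine (Projectivization.mk_eq_mk_iff' K _ _ _ _).2 ⟨t ^ deg f, ?_⟩
    ext i
    fin_cases i <;> simp [lift, eval_homogenize_smul])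

/-- `Fix(fⁿ)`, the set of fixed points of `fⁿ` in `ℙ¹`. -/
def Fix (f : RatFunc K) (n : ℕ) : Set (P1 K) := {w | (ratMap f)^[n] w = w}

/-- `C(fⁿ)`, the set of critical points of `fⁿ` in `ℙ¹`, i.e. the points `π(p)` at which the
differential of `fⁿ = [Fⁿ₀ : Fⁿ₁]` vanishes. In the coordinate `z` and for a finite value of `fⁿ`
the condition for `i = 0` at `p = (z, 1)` is that the numerator of `(fⁿ)'(z)`, computed by the
quotient rule, is zero, and the condition for `i = 1` then follows by Euler's identity. -/
def Crit (f : RatFunc K) (n : ℕ) : Set (P1 K) :=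
  {w | ∀ i : Fin 2,
    MvPolynomial.eval w.rep
      (MvPolynomial.pderiv i (liftIter f n 0) * liftIter f n 1 -
        liftIter f n 0 * MvPolynomial.pderiv i (liftIter f n 1)) = 0}

/-- `SAT(f)`, the set of superattracting periodic points of `f` in `ℙ¹`. -/
def SAT (f : RatFunc K) : Set (P1 K) := ⋃ n : ℕ+, Fix f n ∩ Crit f n

/-- The multiplicity of `w = π(p)` as a root of `fⁿ = Id`: the multiplicity of the linear form
`X ∧ p` in the homogeneous polynomial `X ∧ Fⁿ(X)`, which has degree `dⁿ + 1`. -/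
def fixMult (f : RatFunc K) (n : ℕ) (w : P1 K) : ℕ∞ :=
  emultiplicity
    (MvPolynomial.X 0 * MvPolynomial.C (w.rep 1) - MvPolynomial.X 1 * MvPolynomial.C (w.rep 0))
    (MvPolynomial.X 0 * liftIter f n 1 - MvPolynomial.X 1 * liftIter f n 0)

/-- The measure `[fⁿ = Id] = ∑ δ_w` on `𝖯¹`, the sum over the roots `w ∈ ℙ¹` of `fⁿ = Id` counted
with multiplicity. -/
def fixMeasure (f : RatFunc K) (n : ℕ) : Measure (BerkP1 K) :=
  Measure.sum fun w : Fix f n => (fixMult f n w : ℝ≥0∞) • Measure.dirac (toBerk (w : P1 K))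

/-! ### The dynamical Green function -/

/-- The continuous function `T_{Fⁿ}` on `𝖯¹` that is `log ‖Fⁿ(p)‖ - dⁿ log ‖p‖` at `π(p) ∈ ℙ¹`. -/
def logGrowth (f : RatFunc K) (n : ℕ) (S : BerkP1 K) : ℝ :=
  Real.log (pairNorm K (S.seminorm (liftIter f n 0)) (S.seminorm (liftIter f n 1))) -
    (deg f : ℝ) ^ n * Real.log S.size

/-- `g_F = lim T_{Fⁿ} / dⁿ` on `𝖯¹`. -/
def liftGreen (f : RatFunc K) (S : BerkP1 K) : ℝ :=
  limUnder atTop fun n : ℕ => logGrowth f n S / (deg f : ℝ) ^ n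

/-- The dynamical Green function `g_f = g_F + V_{g_F} / 2` of `f` on `𝖯¹`: the normalized weight
(`V_{g_f} = 0`) with the same associated measure as `g_F`, that is, `μ_f`. It does not depend on
the lift `F`. -/
def green (f : RatFunc K) (S : BerkP1 K) : ℝ :=
  liftGreen f S + (eqEnergy (liftGreen f)).toReal / 2

/-! ### The separation of the superattracting points -/

/-- The infimum in `[0, 1]`, where the chordal metric has its values, of `[c, c']` over the pairs
of distinct points of `SAT(f)`; it is `1` if there is no such pair. -/
def satSep (f : RatFunc K) : ℝ≥0∞ :=
  1 ⊓ ⨅ (c ∈ SAT f) (c' ∈ SAT f) (_ : c ≠ c'), ENNReal.ofReal (chordal c c')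

end BerkDyn

end

noncomputable section

namespace BerkDyn

variable {K : Type*} [NontriviallyNormedField K]

/-! ### The norm of a pair -/

theorem max_le_pairNorm (a b : ℝ) : max a b ≤ pairNorm K a b := by
  unfold pairNorm
  split_ifs
  · exact le_rfl
  · refine max_le (Real.le_sqrt_of_sq_le ?_) (Real.le_sqrt_of_sq_le ?_) <;> nlinarith

theorem pairNorm_le_two_mul_max {a b : ℝ} (ha : 0 ≤ a) (hb : 0 ≤ b) :
    pairNorm K a b ≤ 2 * max a b := by
  have hm : 0 ≤ max a b := ha.trans (le_max_left _ _)
  unfold pairNorm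
  split_ifs
  · linarith
  · refine Real.sqrt_le_iff.2 ⟨by linarith, ?_⟩
    have h₁ := pow_le_pow_left₀ ha (le_max_left a b) 2
    have h₂ := pow_le_pow_left₀ hb (le_max_right a b) 2
    nlinarith

theorem pairNorm_pos {a b : ℝ} (h : 0 < max a b) : 0 < pairNorm K a b :=
  h.trans_le (max_le_pairNorm a b)

theorem pairNorm_mul {a b c : ℝ} (hc : 0 ≤ c) :
    pairNorm K (c * a) (c * b) = c * pairNorm K a b := by
  unfold pairNorm
  split_ifs
  · rw [mul_max_of_nonneg _ _ hc]
  · rw [mul_pow, mul_pow, ← mul_add, Real.sqrt_mul (sq_nonneg c), Real.sqrt_sq hc]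

theorem norm_wedge_le (p q : Fin 2 → K) :
    ‖p 0 * q 1 - p 1 * q 0‖ ≤ pairNorm K ‖p 0‖ ‖p 1‖ * pairNorm K ‖q 0‖ ‖q 1‖ := by
  unfold pairNorm
  split_ifs with h
  · have hle : ∀ i j, ‖p i * q j‖ ≤ max ‖p 0‖ ‖p 1‖ * max ‖q 0‖ ‖q 1‖ := by
      intro i j
      rw [norm_mul]
      refine mul_le_mul ?_ ?_ (norm_nonneg _) ((norm_nonneg _).trans (le_max_left _ _))
      · fin_cases i
        · exact le_max_left _ _
        · exact le_max_right _ _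
      · fin_cases j
        · exact le_max_left _ _
        · exact le_max_right _ _
    rw [sub_eq_add_neg]
    refine (IsUltrametricDist.norm_add_le_max _ _).trans (max_le (hle 0 1) ?_)
    rw [norm_neg]
    exact hle 1 0
  · rw [← Real.sqrt_mul (by positivity)]
    refine (norm_sub_le _ _).trans (Real.le_sqrt_of_sq_le ?_)
    rw [norm_mul, norm_mul]
    nlinarith [sq_nonneg (‖p 0‖ * ‖q 0‖ - ‖p 1‖ * ‖q 1‖)]

/-! ### Growth of homogeneous polynomials under seminorms -/

/-- The value at `N` of the maximum of the coordinates. -/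
def supNorm (N : MulRingSeminorm (MvPolynomial (Fin 2) K)) : ℝ :=
  max (N (MvPolynomial.X 0)) (N (MvPolynomial.X 1))

theorem supNorm_nonneg (N : MulRingSeminorm (MvPolynomial (Fin 2) K)) : 0 ≤ supNorm N :=
  (apply_nonneg N _).trans (le_max_left _ _)

theorem seminorm_X_le_supNorm (N : MulRingSeminorm (MvPolynomial (Fin 2) K)) (i : Fin 2) :
    N (MvPolynomial.X i) ≤ supNorm N := by
  fin_cases i
  · exact le_max_left _ _
  · exact le_max_right _ _

theorem exists_seminorm_le_of_isHomogeneous {d : ℕ} {G : MvPolynomial (Fin 2) K}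
    (hG : G.IsHomogeneous d) :
    ∃ C : ℝ, 0 ≤ C ∧ ∀ N : MulRingSeminorm (MvPolynomial (Fin 2) K),
      (∀ a : K, N (MvPolynomial.C a) = ‖a‖) → N G ≤ C * supNorm N ^ d := by
  refine ⟨∑ m ∈ G.support, ‖G.coeff m‖, Finset.sum_nonneg fun _ _ => norm_nonneg _,
    fun N hN => ?_⟩
  conv_lhs => rw [G.as_sum]
  refine (Finset.le_sum_of_subadditive N (map_zero N).le (map_add_le_add N) _ _).trans ?_
  rw [Finset.sum_mul]
  refine Finset.sum_le_sum fun m hm => ?_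
  have hdeg : m 0 + m 1 = d := by
    have := hG (MvPolynomial.mem_support_iff.1 hm)
    rwa [Finsupp.weight_apply, Finsupp.sum_fintype _ _ (by simp), Fin.sum_univ_two,
      Pi.one_apply, Pi.one_apply, smul_eq_mul, smul_eq_mul, mul_one, mul_one] at this
  rw [MvPolynomial.monomial_eq, Finsupp.prod_fintype _ _ (by simp), Fin.prod_univ_two, map_mul,
    hN, map_mul, map_pow, map_pow, ← hdeg, pow_add]
  have := supNorm_nonneg N
  gcongr <;> exact seminorm_X_le_supNorm N _

theorem isHomogeneous_homogenize (d : ℕ) (P : Polynomial K) : (homogenize d P).IsHomogeneous d := by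
  refine MvPolynomial.IsHomogeneous.sum _ _ _ fun k hk => ?_
  have hk' : 0 + 1 * k + 1 * (d - k) = d := by have := Finset.mem_range.1 hk; omega
  have := ((MvPolynomial.isHomogeneous_C (Fin 2) (P.coeff k)).mul
    ((MvPolynomial.isHomogeneous_X K (0 : Fin 2)).pow k)).mul
    ((MvPolynomial.isHomogeneous_X K (1 : Fin 2)).pow (d - k))
  rwa [hk'] at this

theorem isHomogeneous_lift (f : RatFunc K) (i : Fin 2) : (lift f i).IsHomogeneous (deg f) := by
  fin_cases i <;> exact isHomogeneous_homogenize _ _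

theorem exists_X_pow_eq [IsAlgClosed K] (f : RatFunc K) (i : Fin 2) :
    ∃ (m : ℕ) (A B : MvPolynomial (Fin 2) K), A.IsHomogeneous m ∧ B.IsHomogeneous m ∧
      MvPolynomial.X i ^ (m + deg f) = A * lift f 0 + B * lift f 1 := by
  have hrad : (MvPolynomial.X i : MvPolynomial (Fin 2) K) ∈
      (Ideal.span {lift f 0, lift f 1}).radical := by
    rw [← MvPolynomial.vanishingIdeal_zeroLocus_eq_radical (K := K),
      MvPolynomial.mem_vanishingIdeal_iff]
    intro x hx
    rw [MvPolynomial.zeroLocus_span] at hx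
    by_contra hxi
    refine eval_lift_ne_zero f x (fun h => hxi (by simp [h])) (funext fun j => ?_)
    have := hx (lift f j) (by fin_cases j <;> simp)
    simpa [MvPolynomial.aeval_eq_eval] using this
  obtain ⟨m, hm⟩ := hrad
  obtain ⟨A, B, hAB⟩ := Ideal.mem_span_pair.1 (Ideal.mul_mem_left _
    (MvPolynomial.X i ^ deg f) hm)
  let _ := MvPolynomial.gradedAlgebra (σ := Fin 2) (R := K)
  refine ⟨m, MvPolynomial.homogeneousComponent m A, MvPolynomial.homogeneousComponent m B,
    MvPolynomial.homogeneousComponent_isHomogeneous _ _,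
    MvPolynomial.homogeneousComponent_isHomogeneous _ _, ?_⟩
  have hdec : ∀ (G : MvPolynomial (Fin 2) K) (n : ℕ),
      (DirectSum.decompose (MvPolynomial.homogeneousSubmodule (Fin 2) K) G n :
        MvPolynomial (Fin 2) K) = MvPolynomial.homogeneousComponent n G :=
    MvPolynomial.decomposition.decompose'_apply
  have hcomp : ∀ (G : MvPolynomial (Fin 2) K) (j : Fin 2),
      MvPolynomial.homogeneousComponent (m + deg f) (G * lift f j) =
        MvPolynomial.homogeneousComponent m G * lift f j := by
    intro G j
    have := DirectSum.coe_decompose_mul_add_of_right_mem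
      (MvPolynomial.homogeneousSubmodule (Fin 2) K) (a := G) (i := m)
      ((MvPolynomial.mem_homogeneousSubmodule _ _).2 (isHomogeneous_lift f j))
    simpa only [hdec] using this
  rw [← hcomp, ← hcomp, ← map_add, hAB, ← pow_add, add_comm (deg f) m,
    MvPolynomial.homogeneousComponent_of_mem (n := m + deg f), if_pos rfl]
  simpa using (MvPolynomial.isHomogeneous_X K i).pow (m + deg f)

theorem exists_supNorm_pow_le_lift [IsAlgClosed K] (f : RatFunc K) :
    ∃ C : ℝ, 0 < C ∧ ∀ N : MulRingSeminorm (MvPolynomial (Fin 2) K),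
      (∀ a : K, N (MvPolynomial.C a) = ‖a‖) → 0 < supNorm N →
        supNorm N ^ deg f ≤ C * max (N (lift f 0)) (N (lift f 1)) := by
  have key : ∀ i : Fin 2, ∃ C : ℝ, 0 ≤ C ∧ ∀ N : MulRingSeminorm (MvPolynomial (Fin 2) K),
      (∀ a : K, N (MvPolynomial.C a) = ‖a‖) → supNorm N = N (MvPolynomial.X i) → 0 < supNorm N →
        supNorm N ^ deg f ≤ C * max (N (lift f 0)) (N (lift f 1)) := by
    intro i
    obtain ⟨m, A, B, hA, hB, h⟩ := exists_X_pow_eq f i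
    obtain ⟨C, hC, hAC⟩ := exists_seminorm_le_of_isHomogeneous hA
    obtain ⟨D, hD, hBD⟩ := exists_seminorm_le_of_isHomogeneous hB
    refine ⟨C + D, by positivity, fun N hN hi hpos => ?_⟩
    refine le_of_mul_le_mul_left ?_ (pow_pos hpos m)
    set t := max (N (lift f 0)) (N (lift f 1)) with ht
    calc supNorm N ^ m * supNorm N ^ deg f
        = N (A * lift f 0 + B * lift f 1) := by rw [← h, map_pow, ← hi, pow_add]
      _ ≤ N (A * lift f 0) + N (B * lift f 1) := map_add_le_add N _ _
      _ = N A * N (lift f 0) + N B * N (lift f 1) := by rw [map_mul, map_mul]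
      _ ≤ C * supNorm N ^ m * t + D * supNorm N ^ m * t := by
          have := supNorm_nonneg N
          gcongr
          · exact hAC N hN
          · exact le_max_left _ _
          · exact hBD N hN
          · exact le_max_right _ _
      _ = supNorm N ^ m * ((C + D) * t) := by ring
  obtain ⟨C, hC, h₀⟩ := key 0
  obtain ⟨D, hD, h₁⟩ := key 1
  refine ⟨C + D + 1, by positivity, fun N hN hpos => ?_⟩
  have ht : 0 ≤ max (N (lift f 0)) (N (lift f 1)) := (apply_nonneg N _).trans (le_max_left _ _)
  rcases max_choice (N (MvPolynomial.X 0)) (N (MvPolynomial.X 1)) with h | h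
  · exact (h₀ N hN h hpos).trans (mul_le_mul_of_nonneg_right (by linarith) ht)
  · exact (h₁ N hN h hpos).trans (mul_le_mul_of_nonneg_right (by linarith) ht)

/-- `log ‖F‖` differs from `d log ‖X‖` by a bounded amount, uniformly over all seminorms. -/
theorem exists_abs_log_lift_sub_le [IsAlgClosed K] (f : RatFunc K) :
    ∃ C : ℝ, ∀ N : MulRingSeminorm (MvPolynomial (Fin 2) K),
      (∀ a : K, N (MvPolynomial.C a) = ‖a‖) → 0 < supNorm N →
        0 < max (N (lift f 0)) (N (lift f 1)) ∧
        |Real.log (pairNorm K (N (lift f 0)) (N (lift f 1))) -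
          deg f * Real.log (pairNorm K (N (MvPolynomial.X 0)) (N (MvPolynomial.X 1)))| ≤ C := by
  obtain ⟨A, hA, hlow⟩ := exists_supNorm_pow_le_lift f
  obtain ⟨B₀, hB₀, hup₀⟩ := exists_seminorm_le_of_isHomogeneous (isHomogeneous_lift f 0)
  obtain ⟨B₁, hB₁, hup₁⟩ := exists_seminorm_le_of_isHomogeneous (isHomogeneous_lift f 1)
  set D : ℝ := (deg f : ℝ)
  have hD : 0 ≤ D := Nat.cast_nonneg _
  refine ⟨|Real.log A| + |Real.log (B₀ + B₁ + 1)| + (1 + D) * Real.log 2, fun N hN hpos => ?_⟩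
  set s := supNorm N with hs
  set t := max (N (lift f 0)) (N (lift f 1)) with ht
  have hlow' := hlow N hN hpos
  have htpos : 0 < t := pos_of_mul_pos_right ((pow_pos hpos _).trans_le hlow') hA.le
  refine ⟨htpos, ?_⟩
  have hup : t ≤ (B₀ + B₁ + 1) * s ^ deg f := by
    have := pow_pos hpos (deg f)
    refine max_le ((hup₀ N hN).trans ?_) ((hup₁ N hN).trans ?_) <;>
      exact mul_le_mul_of_nonneg_right (by linarith) this.le
  have hlog : ∀ a b : ℝ, 0 ≤ a → 0 ≤ b → 0 < max a b →
      Real.log (max a b) ≤ Real.log (pairNorm K a b) ∧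
      Real.log (pairNorm K a b) ≤ Real.log 2 + Real.log (max a b) := by
    intro a b ha hb hab
    refine ⟨Real.log_le_log hab (max_le_pairNorm a b), ?_⟩
    rw [← Real.log_mul two_ne_zero hab.ne']
    exact Real.log_le_log (pairNorm_pos hab) (pairNorm_le_two_mul_max ha hb)
  obtain ⟨h₁, h₂⟩ := hlog _ _ (apply_nonneg N (lift f 0)) (apply_nonneg N (lift f 1)) htpos
  obtain ⟨h₃, h₄⟩ := hlog _ _ (apply_nonneg N (MvPolynomial.X 0))
    (apply_nonneg N (MvPolynomial.X 1)) hpos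
  have h₅ : D * Real.log s ≤ Real.log A + Real.log t := by
    rw [← Real.log_mul hA.ne' htpos.ne', ← Real.log_pow]
    exact Real.log_le_log (pow_pos hpos _) hlow'
  have h₆ : Real.log t ≤ Real.log (B₀ + B₁ + 1) + D * Real.log s := by
    rw [← Real.log_pow, ← Real.log_mul (by positivity) (pow_pos hpos _).ne']
    exact Real.log_le_log htpos hup
  have h₇ := mul_le_mul_of_nonneg_left h₃ hD
  have h₈ := mul_le_mul_of_nonneg_left h₄ hD
  have h2 : 0 ≤ Real.log 2 := Real.log_nonneg one_le_two
  have := le_abs_self (Real.log A)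
  have := le_abs_self (Real.log (B₀ + B₁ + 1))
  have := abs_nonneg (Real.log A)
  have := abs_nonneg (Real.log (B₀ + B₁ + 1))
  change Real.log t ≤ _ at h₁
  change _ ≤ Real.log 2 + Real.log t at h₂
  change D * Real.log s ≤ _ at h₇
  change _ ≤ D * (Real.log 2 + Real.log s) at h₈
  rw [abs_le]
  constructor <;> nlinarith

/-! ### Boundedness of the Green function -/

theorem BerkP1.seminorm_C (S : BerkP1 K) (a : K) : S.seminorm (MvPolynomial.C a) = ‖a‖ :=
  (Quotient.out (s := coneSetoid K) S).2.1 a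

theorem BerkP1.supNorm_pos (S : BerkP1 K) : 0 < supNorm S.seminorm := by
  obtain ⟨i, hi⟩ := (Quotient.out (s := coneSetoid K) S).2.2
  exact ((apply_nonneg S.seminorm _).lt_of_ne' hi).trans_le (seminorm_X_le_supNorm _ i)

theorem BerkP1.size_pos (S : BerkP1 K) : 0 < S.size :=
  pairNorm_pos S.supNorm_pos

/-- The image of a seminorm under the polynomial map `H`. -/
def pushSeminorm (N : MulRingSeminorm (MvPolynomial (Fin 2) K))
    (H : Fin 2 → MvPolynomial (Fin 2) K) : MulRingSeminorm (MvPolynomial (Fin 2) K) where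
  toFun G := N (MvPolynomial.bind₁ H G)
  map_zero' := by simp
  add_le' G G' := by simpa using map_add_le_add N _ _
  neg' G := by simp
  map_one' := by simp
  map_mul' G G' := by simp

theorem pushSeminorm_apply (N : MulRingSeminorm (MvPolynomial (Fin 2) K))
    (H : Fin 2 → MvPolynomial (Fin 2) K) (G : MvPolynomial (Fin 2) K) :
    pushSeminorm N H G = N (MvPolynomial.bind₁ H G) :=
  rfl

theorem pushSeminorm_C {N : MulRingSeminorm (MvPolynomial (Fin 2) K)}
    (hN : ∀ a : K, N (MvPolynomial.C a) = ‖a‖) (H : Fin 2 → MvPolynomial (Fin 2) K) (a : K) :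
    pushSeminorm N H (MvPolynomial.C a) = ‖a‖ := by
  rw [pushSeminorm_apply, MvPolynomial.bind₁_C_right, hN]

theorem supNorm_pushSeminorm (N : MulRingSeminorm (MvPolynomial (Fin 2) K))
    (H : Fin 2 → MvPolynomial (Fin 2) K) :
    supNorm (pushSeminorm N H) = max (N (H 0)) (N (H 1)) := by
  simp [supNorm, pushSeminorm_apply]

theorem supNorm_pushSeminorm_liftIter_pos [IsAlgClosed K] (f : RatFunc K) (S : BerkP1 K) (n : ℕ) :
    0 < supNorm (pushSeminorm S.seminorm (liftIter f n)) := by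
  induction n with
  | zero => rw [supNorm_pushSeminorm]; exact S.supNorm_pos
  | succ n ih =>
    obtain ⟨C, hC⟩ := exists_abs_log_lift_sub_le f
    rw [supNorm_pushSeminorm]
    exact (hC _ (pushSeminorm_C S.seminorm_C _) ih).1

theorem exists_abs_liftGreen_le [IsAlgClosed K] (f : RatFunc K) (hd : 1 < deg f) :
    ∃ C : ℝ, ∀ S : BerkP1 K, |liftGreen f S| ≤ C := by
  obtain ⟨C, hC⟩ := exists_abs_log_lift_sub_le f
  set D : ℝ := (deg f : ℝ) with hD
  have hD1 : 1 < D := Nat.one_lt_cast.2 hd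
  have hD0 : 0 < D := by linarith
  refine ⟨C / D / (1 - D⁻¹), fun S => ?_⟩
  set u : ℕ → ℝ := fun n => logGrowth f n S / D ^ n with hu
  have hstep : ∀ n, dist (u n) (u (n + 1)) ≤ C / D * D⁻¹ ^ n := by
    intro n
    have h := (hC _ (pushSeminorm_C S.seminorm_C (liftIter f n))
      (supNorm_pushSeminorm_liftIter_pos f S n)).2
    simp only [pushSeminorm_apply, MvPolynomial.bind₁_X_right] at h
    have heq : u (n + 1) - u n = (logGrowth f (n + 1) S - D * logGrowth f n S) / D ^ (n + 1) := by
      simp only [hu, pow_succ]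
      field_simp
    have hnum : logGrowth f (n + 1) S - D * logGrowth f n S =
        Real.log (pairNorm K (S.seminorm (MvPolynomial.bind₁ (liftIter f n) (lift f 0)))
          (S.seminorm (MvPolynomial.bind₁ (liftIter f n) (lift f 1)))) -
        D * Real.log (pairNorm K (S.seminorm (liftIter f n 0)) (S.seminorm (liftIter f n 1))) := by
      simp only [logGrowth, liftIter, ← hD, pow_succ]
      ring
    rw [dist_comm, Real.dist_eq, heq, hnum, abs_div, abs_of_pos (pow_pos hD0 (n + 1)),
      inv_pow, ← div_eq_mul_inv, div_div, ← pow_succ']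
    gcongr
  have hr : D⁻¹ < 1 := inv_lt_one_of_one_lt₀ hD1
  have hlim : Tendsto u atTop (𝓝 (liftGreen f S)) :=
    (cauchySeq_of_le_geometric _ _ hr hstep).tendsto_limUnder
  have h0 : u 0 = 0 := by simp [hu, logGrowth, liftIter, BerkP1.size]
  simpa [h0] using dist_le_of_le_geometric_of_tendsto₀ _ _ hr hstep hlim

theorem iSup_enorm_green_lt_top [IsAlgClosed K] (f : RatFunc K) (hd : 1 < deg f) :
    (⨆ S : BerkP1 K, ‖green f S‖ₑ) < ⊤ := by
  obtain ⟨C, hC⟩ := exists_abs_liftGreen_le f hd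
  set v : ℝ := (eqEnergy (liftGreen f)).toReal / 2 with hv
  refine lt_of_le_of_lt (iSup_le fun S => ?_) (ENNReal.ofReal_lt_top (r := C + |v|))
  rw [← ofReal_norm, Real.norm_eq_abs]
  exact ENNReal.ofReal_le_ofReal ((abs_add_le _ _).trans (add_le_add_left (hC S) _))

/-! ### The classical points of the Berkovich line -/

/-- The norm of the chosen representative of `z`. -/
def repNorm (z : P1 K) : ℝ := pairNorm K ‖z.rep 0‖ ‖z.rep 1‖

theorem repNorm_pos (z : P1 K) : 0 < repNorm z := by
  refine pairNorm_pos ?_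
  obtain ⟨i, hi⟩ := Function.ne_iff.1 z.rep_nonzero
  refine (norm_pos_iff.2 hi).trans_le ?_
  fin_cases i
  · exact le_max_left _ _
  · exact le_max_right _ _

/-- The linear form `X ∧ p` for the chosen representative `p` of `w`. -/
def lineForm (w : P1 K) : MvPolynomial (Fin 2) K :=
  MvPolynomial.X 0 * MvPolynomial.C (w.rep 1) - MvPolynomial.X 1 * MvPolynomial.C (w.rep 0)

theorem isHomogeneous_lineForm (w : P1 K) : (lineForm w).IsHomogeneous 1 :=
  ((MvPolynomial.isHomogeneous_X K 0).mul (MvPolynomial.isHomogeneous_C _ _)).sub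
    ((MvPolynomial.isHomogeneous_X K 1).mul (MvPolynomial.isHomogeneous_C _ _))

theorem eval_lineForm (w : P1 K) (p : Fin 2 → K) :
    MvPolynomial.eval p (lineForm w) = p 0 * w.rep 1 - p 1 * w.rep 0 := by
  simp [lineForm]

theorem eval_lineForm_self (w : P1 K) : MvPolynomial.eval w.rep (lineForm w) = 0 := by
  rw [eval_lineForm]
  ring

theorem eval_lineForm_eq_zero_iff {z w : P1 K} :
    MvPolynomial.eval z.rep (lineForm w) = 0 ↔ z = w := by
  refine ⟨fun h => ?_, fun h => h ▸ eval_lineForm_self w⟩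
  rw [eval_lineForm, sub_eq_zero] at h
  rw [← z.mk_rep, ← w.mk_rep, Projectivization.mk_eq_mk_iff']
  by_cases h1 : w.rep 1 = 0
  · have h0 : w.rep 0 ≠ 0 := by
      intro h0
      exact w.rep_nonzero (funext fun i => by fin_cases i <;> assumption)
    have hz : z.rep 1 = 0 := by simpa [h1, h0] using h.symm
    refine ⟨z.rep 0 / w.rep 0, funext fun i => ?_⟩
    fin_cases i
    · simp [h0]
    · simp [h1, hz]
  · refine ⟨z.rep 1 / w.rep 1, funext fun i => ?_⟩
    fin_cases i
    · simp only [Fin.zero_eta, Pi.smul_apply, smul_eq_mul]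
      field_simp
      rw [← h, mul_comm]
    · simp [h1]

theorem chordal_eq (z w : P1 K) :
    chordal z w = ‖MvPolynomial.eval z.rep (lineForm w)‖ / (repNorm z * repNorm w) := by
  rw [eval_lineForm]
  rfl

theorem chordal_self (z : P1 K) : chordal z z = 0 := by
  rw [chordal_eq, eval_lineForm_self, norm_zero, zero_div]

theorem chordal_comm (z w : P1 K) : chordal z w = chordal w z := by
  unfold chordal
  rw [mul_comm (pairNorm K _ _), norm_sub_rev, mul_comm (z.rep 1), mul_comm (z.rep 0)]

theorem chordal_pos {z w : P1 K} (h : z ≠ w) : 0 < chordal z w := by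
  rw [chordal_eq]
  exact div_pos (norm_pos_iff.2 (mt eval_lineForm_eq_zero_iff.1 h))
    (mul_pos (repNorm_pos z) (repNorm_pos w))

theorem chordal_le_one (z w : P1 K) : chordal z w ≤ 1 :=
  div_le_one_of_le₀ (norm_wedge_le _ _) (mul_pos (repNorm_pos z) (repNorm_pos w)).le

theorem abs_chordal_mul_sub_le (z w c c' : P1 K) :
    |chordal z w * chordal c c' - chordal z c' * chordal w c| ≤
      chordal z c * chordal w c' := by
  have hz := repNorm_pos z
  have hw := repNorm_pos w
  have hc := repNorm_pos c
  have hc' := repNorm_pos c'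
  set n := repNorm z * repNorm w * repNorm c * repNorm c' with hn
  have hn0 : 0 < n := by positivity
  have e : ∀ a b a' b' : P1 K, repNorm a * repNorm b * (repNorm a' * repNorm b') = n →
      chordal a b * chordal a' b' = ‖MvPolynomial.eval a.rep (lineForm b) *
        MvPolynomial.eval a'.rep (lineForm b')‖ / n := by
    intro a b a' b' h
    rw [chordal_eq, chordal_eq, div_mul_div_comm, h, norm_mul]
  rw [e z w c c' (by rw [hn]; ring), e z c' w c (by rw [hn]; ring), e z c w c' (by rw [hn]; ring),
    ← sub_div, abs_div, abs_of_pos hn0]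
  gcongr
  rw [← norm_neg (MvPolynomial.eval z.rep (lineForm c') * _)]
  refine (abs_norm_sub_norm_le _ _).trans_eq (congrArg _ ?_)
  simp only [eval_lineForm]
  ring

theorem exists_seminorm_toBerk_eq (z : P1 K) :
    ∃ C : ℝ, 0 < C ∧ ∀ (d : ℕ) (G : MvPolynomial (Fin 2) K), G.IsHomogeneous d →
      (toBerk z).seminorm G = C ^ d * ‖MvPolynomial.eval z.rep G‖ :=
  Quotient.exact (Quotient.out_eq (toBerk z))

theorem seminorm_div_size_toBerk (z : P1 K) {d : ℕ} {G : MvPolynomial (Fin 2) K}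
    (hG : G.IsHomogeneous d) :
    (toBerk z).seminorm G / (toBerk z).size ^ d =
      ‖MvPolynomial.eval z.rep G‖ / repNorm z ^ d := by
  obtain ⟨C, hC, h⟩ := exists_seminorm_toBerk_eq z
  have hsize : (toBerk z).size = C * repNorm z := by
    rw [BerkP1.size, h 1 _ (MvPolynomial.isHomogeneous_X K 0),
      h 1 _ (MvPolynomial.isHomogeneous_X K 1), pow_one, pairNorm_mul hC.le]
    simp [repNorm]
  rw [h d G hG, hsize, mul_pow, mul_div_mul_left _ _ (pow_pos hC d).ne']

theorem toBerk_injective : Function.Injective (toBerk : P1 K → BerkP1 K) := by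
  intro z w h
  have h₁ := seminorm_div_size_toBerk z (isHomogeneous_lineForm w)
  rw [h, seminorm_div_size_toBerk w (isHomogeneous_lineForm w), eval_lineForm_self, norm_zero,
    zero_div, eq_comm, div_eq_zero_iff, or_iff_left (pow_pos (repNorm_pos z) 1).ne',
    norm_eq_zero] at h₁
  exact eval_lineForm_eq_zero_iff.1 h₁

theorem continuous_seminorm_div_size {d : ℕ} {G : MvPolynomial (Fin 2) K}
    (hG : G.IsHomogeneous d) : Continuous fun S : BerkP1 K => S.seminorm G / S.size ^ d :=
  continuous_iff_le_induced.2 <| (iInf_le _ d).trans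
    (iInf_le (fun G : MvPolynomial.homogeneousSubmodule (Fin 2) K d =>
      TopologicalSpace.induced (fun S : BerkP1 K => S.seminorm G.1 / S.size ^ d) inferInstance)
      ⟨G, hG⟩)

instance : T2Space (BerkP1 K) := by
  refine ⟨fun S S' hne => ?_⟩
  by_cases h : ∀ (d : ℕ) (G : MvPolynomial (Fin 2) K), G.IsHomogeneous d →
      S.seminorm G / S.size ^ d = S'.seminorm G / S'.size ^ d
  · refine absurd ((Quotient.out_equiv_out (s := coneSetoid K) (x := S) (y := S')).1 ?_) hne
    refine ⟨S.size / S'.size, div_pos S.size_pos S'.size_pos, fun d G hG => ?_⟩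
    have := h d G hG
    rw [div_eq_iff (pow_pos S.size_pos d).ne'] at this
    change S.seminorm G = _ * S'.seminorm G
    rw [this, div_pow]
    ring
  · push Not at h
    obtain ⟨d, G, hG, hne'⟩ := h
    exact separated_by_continuous (continuous_seminorm_div_size hG) hne'

/-- The chordal metric is continuous in the first variable for the topology induced by `𝖯¹`. -/
theorem tendsto_chordal_comap_toBerk (c w : P1 K) :
    Tendsto (fun z => chordal z w) (comap toBerk (𝓝 (toBerk c))) (𝓝 (chordal c w)) := by
  have key : ∀ z : P1 K, chordal z w =
      (toBerk z).seminorm (lineForm w) / (toBerk z).size ^ 1 / repNorm w := by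
    intro z
    rw [seminorm_div_size_toBerk z (isHomogeneous_lineForm w), chordal_eq, pow_one, div_div]
  simp_rw [key]
  exact (((continuous_seminorm_div_size (isHomogeneous_lineForm w)).tendsto _).comp
    tendsto_comap).div_const _

theorem hsia_toBerk {c c' : P1 K} (hne : c ≠ c') : hsia (toBerk c) (toBerk c') = chordal c c' := by
  set l := comap (Prod.map toBerk toBerk) (𝓝 (toBerk c, toBerk c')) with hl
  have hfst : Tendsto Prod.fst l (comap toBerk (𝓝 (toBerk c))) :=
    tendsto_comap_iff.2 ((continuous_fst.tendsto (toBerk c, toBerk c')).comp tendsto_comap)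
  have hsnd : Tendsto Prod.snd l (comap toBerk (𝓝 (toBerk c'))) :=
    tendsto_comap_iff.2 ((continuous_snd.tendsto (toBerk c, toBerk c')).comp tendsto_comap)
  have : l.NeBot := by
    have hpure : pure (c, c') ≤ l := by
      rw [hl, ← map_le_iff_le_comap, map_pure]
      exact pure_le_nhds (toBerk c, toBerk c')
    exact neBot_of_le hpure
  have hpos := chordal_pos hne
  have h₁ := (tendsto_chordal_comap_toBerk c c').comp hfst
  have h₂ := (tendsto_chordal_comap_toBerk c' c).comp hsnd
  have h₃ := (tendsto_chordal_comap_toBerk c c).comp hfst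
  have h₄ := (tendsto_chordal_comap_toBerk c' c').comp hsnd
  have hsmall : Tendsto (fun p : P1 K × P1 K => chordal p.1 p.2 * chordal c c' -
      chordal p.1 c' * chordal p.2 c) l (𝓝 0) := by
    refine squeeze_zero_norm (fun p => abs_chordal_mul_sub_le p.1 p.2 c c') ?_
    simpa [Function.comp_def, chordal_self] using h₃.mul h₄
  have hmul : Tendsto (fun p : P1 K × P1 K => chordal p.1 p.2 * chordal c c') l
      (𝓝 (chordal c c' * chordal c c')) := by
    have := hsmall.add (h₁.mul h₂)
    simpa [Function.comp_def, chordal_comm c' c] using this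
  have hlim := hmul.div_const (chordal c c')
  simp only [mul_div_cancel_right₀ _ hpos.ne'] at hlim
  exact hlim.limsup_eq

/-! ### Iterates of the lift -/

theorem eval_smul_of_isHomogeneous {d : ℕ} {G : MvPolynomial (Fin 2) K} (hG : G.IsHomogeneous d)
    (t : K) (p : Fin 2 → K) :
    MvPolynomial.eval (t • p) G = t ^ d * MvPolynomial.eval p G := by
  rw [MvPolynomial.eval_eq, MvPolynomial.eval_eq, Finset.mul_sum]
  refine Finset.sum_congr rfl fun m hm => ?_
  have hdeg : m 0 + m 1 = d := by
    have := hG (MvPolynomial.mem_support_iff.1 hm)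
    rwa [Finsupp.weight_apply, Finsupp.sum_fintype _ _ (by simp), Fin.sum_univ_two,
      Pi.one_apply, Pi.one_apply, smul_eq_mul, smul_eq_mul, mul_one, mul_one] at this
  rw [Finset.prod_subset (Finset.subset_univ m.support)
      (fun i _ hi => by simp [Finsupp.notMem_support_iff.1 hi]),
    Finset.prod_subset (Finset.subset_univ m.support)
      (fun i _ hi => by simp [Finsupp.notMem_support_iff.1 hi]),
    Fin.prod_univ_two, Fin.prod_univ_two, ← hdeg]
  simp only [Pi.smul_apply, smul_eq_mul, mul_pow, pow_add]
  ring

/-- The value of `Fⁿ` at `p`. -/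
def iterVal (f : RatFunc K) (n : ℕ) (p : Fin 2 → K) : Fin 2 → K :=
  fun i => MvPolynomial.eval p (liftIter f n i)

theorem eval_bind (H : Fin 2 → MvPolynomial (Fin 2) K) (G : MvPolynomial (Fin 2) K)
    (p : Fin 2 → K) :
    MvPolynomial.eval p (MvPolynomial.bind₁ H G) =
      MvPolynomial.eval (fun i => MvPolynomial.eval p (H i)) G := by
  simpa [MvPolynomial.aeval_eq_eval] using MvPolynomial.aeval_bind₁ p H G

theorem iterVal_zero (f : RatFunc K) (p : Fin 2 → K) : iterVal f 0 p = p :=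
  funext fun i => MvPolynomial.eval_X i

theorem iterVal_succ (f : RatFunc K) (n : ℕ) (p : Fin 2 → K) :
    iterVal f (n + 1) p = fun i => MvPolynomial.eval (iterVal f n p) (lift f i) :=
  funext fun _ => eval_bind _ _ _

theorem iterVal_ne_zero (f : RatFunc K) (n : ℕ) {p : Fin 2 → K} (hp : p ≠ 0) :
    iterVal f n p ≠ 0 := by
  induction n with
  | zero => rwa [iterVal_zero]
  | succ n ih => rw [iterVal_succ]; exact eval_lift_ne_zero f _ ih

theorem ratMap_iterate_mk (f : RatFunc K) (n : ℕ) {p : Fin 2 → K} (hp : p ≠ 0) :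
    (ratMap f)^[n] (Projectivization.mk K p hp) =
      Projectivization.mk K (iterVal f n p) (iterVal_ne_zero f n hp) := by
  induction n with
  | zero => simp [iterVal_zero]
  | succ n ih =>
    rw [Function.iterate_succ_apply', ih]
    simp only [iterVal_succ]
    rfl

theorem isHomogeneous_liftIter (f : RatFunc K) (n : ℕ) (i : Fin 2) :
    (liftIter f n i).IsHomogeneous (deg f ^ n) := by
  induction n generalizing i with
  | zero => simpa [liftIter] using MvPolynomial.isHomogeneous_X K i
  | succ n ih => rw [pow_succ]; exact (isHomogeneous_lift f i).aeval _ ih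

theorem liftIter_one (f : RatFunc K) : liftIter f 1 = lift f :=
  funext fun i => by simp [liftIter, MvPolynomial.bind₁_X_left]

/-! ### Critical points -/

/-- The numerators `∂ᵢH₀ · H₁ - H₀ · ∂ᵢH₁` of the partial derivatives of `H₀ / H₁`. -/
def critForm (H : Fin 2 → MvPolynomial (Fin 2) K) (i : Fin 2) : MvPolynomial (Fin 2) K :=
  MvPolynomial.pderiv i (H 0) * H 1 - H 0 * MvPolynomial.pderiv i (H 1)

theorem mem_Crit_iff {f : RatFunc K} {n : ℕ} {w : P1 K} :
    w ∈ Crit f n ↔ ∀ i, MvPolynomial.eval w.rep (critForm (liftIter f n) i) = 0 :=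
  Iff.rfl

theorem isHomogeneous_critForm {d : ℕ} {H : Fin 2 → MvPolynomial (Fin 2) K}
    (hH : ∀ i, (H i).IsHomogeneous d) (i : Fin 2) :
    (critForm H i).IsHomogeneous (d - 1 + d) := by
  refine ((hH 0).pderiv.mul (hH 1)).sub ?_
  rw [add_comm]
  exact (hH 0).mul (hH 1).pderiv

theorem mk_mem_Crit_iff {f : RatFunc K} {n : ℕ} {p : Fin 2 → K} (hp : p ≠ 0) :
    Projectivization.mk K p hp ∈ Crit f n ↔
      ∀ i, MvPolynomial.eval p (critForm (liftIter f n) i) = 0 := by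
  obtain ⟨t, ht⟩ := Projectivization.exists_smul_eq_mk_rep K p hp
  rw [mem_Crit_iff, ← ht]
  refine forall_congr' fun i => ?_
  rw [Units.smul_def,
    eval_smul_of_isHomogeneous (isHomogeneous_critForm (isHomogeneous_liftIter f n) i)]
  simp

theorem critForm_euler {d : ℕ} {H : Fin 2 → MvPolynomial (Fin 2) K}
    (hH : ∀ i, (H i).IsHomogeneous d) :
    MvPolynomial.X 0 * critForm H 0 + MvPolynomial.X 1 * critForm H 1 = 0 := by
  have h0 := (hH 0).sum_X_mul_pderiv
  have h1 := (hH 1).sum_X_mul_pderiv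
  rw [Fin.sum_univ_two] at h0 h1
  simp only [nsmul_eq_mul] at h0 h1
  unfold critForm
  linear_combination H 1 * h0 - H 0 * h1

theorem pderiv_bind₁ (H : Fin 2 → MvPolynomial (Fin 2) K) (G : MvPolynomial (Fin 2) K)
    (i : Fin 2) :
    MvPolynomial.pderiv i (MvPolynomial.bind₁ H G) =
      ∑ k, MvPolynomial.bind₁ H (MvPolynomial.pderiv k G) * MvPolynomial.pderiv i (H k) := by
  induction G using MvPolynomial.induction_on with
  | C a => simp
  | add P Q hP hQ =>
    simp only [map_add, hP, hQ, add_mul, Finset.sum_add_distrib]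
  | mul_X P j hP =>
    simp only [map_mul, MvPolynomial.bind₁_X_right, Derivation.leibniz, smul_eq_mul, hP,
      Fin.sum_univ_two, map_add]
    fin_cases j <;> simp [MvPolynomial.pderiv_X] <;> ring

theorem critForm_bind₁ (F H : Fin 2 → MvPolynomial (Fin 2) K) (i : Fin 2) :
    critForm (fun j => MvPolynomial.bind₁ H (F j)) i =
      ∑ k, MvPolynomial.bind₁ H (critForm F k) * MvPolynomial.pderiv i (H k) := by
  simp only [critForm, pderiv_bind₁, Fin.sum_univ_two, map_sub, map_mul]
  ring

/-- The chain rule for critical points. -/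
theorem mem_Crit_succ_iff {f : RatFunc K} {n : ℕ} {w : P1 K} :
    w ∈ Crit f (n + 1) ↔ (ratMap f)^[n] w ∈ Crit f 1 ∨ w ∈ Crit f n := by
  obtain ⟨p, hp, rfl⟩ : ∃ p, ∃ hp : p ≠ 0, Projectivization.mk K p hp = w :=
    ⟨w.rep, w.rep_nonzero, w.mk_rep⟩
  rw [ratMap_iterate_mk, mk_mem_Crit_iff, mk_mem_Crit_iff, mk_mem_Crit_iff, liftIter_one]
  set q := iterVal f n p with hq
  have hq0 : q ≠ 0 := iterVal_ne_zero f n hp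
  set W : Fin 2 → K := fun k => MvPolynomial.eval q (critForm (lift f) k) with hW
  have heuler : q 0 * W 0 + q 1 * W 1 = 0 := by
    simpa using congrArg (MvPolynomial.eval q) (critForm_euler (isHomogeneous_lift f))
  obtain ⟨μ, hμ0, hμ1⟩ : ∃ μ, W 0 = μ * q 1 ∧ W 1 = -(μ * q 0) := by
    by_cases h : q 1 = 0
    · have h0 : q 0 ≠ 0 := by
        intro h0
        exact hq0 (funext fun i => by fin_cases i <;> assumption)
      refine ⟨-W 1 / q 0, ?_, ?_⟩
      · simpa [h, h0] using heuler
      · field_simp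
    · refine ⟨W 0 / q 1, ?_, ?_⟩
      · field_simp
      · field_simp
        linear_combination heuler
  have hchain : ∀ i, MvPolynomial.eval p (critForm (liftIter f (n + 1)) i) =
      μ * MvPolynomial.eval p (critForm (liftIter f n) i) := by
    intro i
    have hk : ∀ k, MvPolynomial.eval p (MvPolynomial.bind₁ (liftIter f n) (critForm (lift f) k)) =
        W k := fun k => eval_bind _ _ _
    have h0 : MvPolynomial.eval p (liftIter f n 0) = q 0 := rfl
    have h1 : MvPolynomial.eval p (liftIter f n 1) = q 1 := rfl
    rw [show critForm (liftIter f (n + 1)) i = _ from critForm_bind₁ (lift f) (liftIter f n) i,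
      Fin.sum_univ_two]
    simp only [map_add, map_mul, hk, hμ0, hμ1]
    simp only [critForm, map_sub, map_mul, h0, h1]
    ring
  have hWμ : (∀ k, W k = 0) ↔ μ = 0 := by
    constructor
    · intro h
      by_contra hμ
      have h0 := h 0
      have h1 := h 1
      rw [hμ0] at h0
      rw [hμ1] at h1
      refine hq0 (funext fun i => ?_)
      fin_cases i
      · simpa [hμ] using h1
      · simpa [hμ] using h0
    · rintro rfl k
      fin_cases k
      · simpa using hμ0
      · simpa using hμ1
  simp only [hchain, mul_eq_zero]
  rw [hWμ, forall_or_left]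

theorem notMem_Crit_zero {f : RatFunc K} {w : P1 K} : w ∉ Crit f 0 := by
  intro h
  refine w.rep_nonzero (funext fun i => ?_)
  have h0 := mem_Crit_iff.1 h 0
  have h1 := mem_Crit_iff.1 h 1
  simp [critForm, liftIter, MvPolynomial.pderiv_X] at h0 h1
  fin_cases i
  · exact h1
  · exact h0

theorem mem_Crit_iff_exists {f : RatFunc K} {n : ℕ} {w : P1 K} :
    w ∈ Crit f n ↔ ∃ k < n, (ratMap f)^[k] w ∈ Crit f 1 := by
  induction n with
  | zero => simp [notMem_Crit_zero]
  | succ n ih => rw [mem_Crit_succ_iff, ih, Nat.exists_lt_succ_right, or_comm]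

theorem eval_pderiv_homogenize (d : ℕ) (P : Polynomial K) (hP : P.natDegree ≤ d) (z : K) :
    MvPolynomial.eval (![z, 1] : Fin 2 → K) (MvPolynomial.pderiv 0 (homogenize d P)) =
      P.derivative.eval z := by
  rw [Polynomial.derivative_eval, Polynomial.sum_over_range' _ (by simp) (d + 1) (by omega),
    homogenize, map_sum, map_sum]
  refine Finset.sum_congr rfl fun k _ => ?_
  simp [MvPolynomial.pderiv_X, mul_assoc]

theorem wronskian_num_denom_ne_zero [CharZero K] {f : RatFunc K} (hd : 0 < deg f) :
    f.denom.wronskian f.num ≠ 0 := by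
  intro h
  obtain ⟨h1, h0⟩ := f.isCoprime_num_denom.symm.wronskian_eq_zero_iff.1 h
  have h0' := Polynomial.derivative_eq_zero.1 h0
  have h1' := Polynomial.derivative_eq_zero.1 h1
  simp [deg, h0', h1'] at hd

theorem finite_Crit_one [CharZero K] {f : RatFunc K} (hd : 0 < deg f) : (Crit f 1).Finite := by
  have hw := wronskian_num_denom_ne_zero hd
  have hz : ∀ z : K, (![z, 1] : Fin 2 → K) ≠ 0 := fun z h => one_ne_zero (congrFun h 1)
  have h10 : (![1, 0] : Fin 2 → K) ≠ 0 := fun h => one_ne_zero (congrFun h 0)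
  refine (((Polynomial.finite_setOfPred_isRoot hw).image
    fun z => Projectivization.mk K ![z, 1] (hz z)).union
    (finite_singleton (Projectivization.mk K ![1, 0] h10))).subset fun (w : P1 K) hcrit => ?_
  by_cases h1 : w.rep 1 = 0
  · right
    rw [mem_singleton_iff, ← w.mk_rep, Projectivization.mk_eq_mk_iff']
    exact ⟨w.rep 0, funext fun i => by fin_cases i <;> simp [h1]⟩
  · left
    have hmk : Projectivization.mk K ![w.rep 0 / w.rep 1, 1] (hz _) = w := by
      conv_rhs => rw [← w.mk_rep]
      rw [Projectivization.mk_eq_mk_iff']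
      refine ⟨(w.rep 1)⁻¹, funext fun i => ?_⟩
      fin_cases i
      · simp [div_eq_inv_mul]
      · simp [h1]
    refine ⟨w.rep 0 / w.rep 1, ?_, hmk⟩
    rw [← hmk, mk_mem_Crit_iff, liftIter_one] at hcrit
    have h := hcrit 0
    have e : ∀ P : Polynomial K, P.natDegree ≤ deg f →
        MvPolynomial.eval (![w.rep 0 / w.rep 1, 1] : Fin 2 → K) (homogenize (deg f) P) =
          P.eval (w.rep 0 / w.rep 1) := by
      intro P hP
      rw [eval_homogenize_of_ne _ _ hP _ (by simp)]
      simp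
    have ed : ∀ P : Polynomial K, P.natDegree ≤ deg f →
        MvPolynomial.eval (![w.rep 0 / w.rep 1, 1] : Fin 2 → K)
          (MvPolynomial.pderiv 0 (homogenize (deg f) P)) =
            P.derivative.eval (w.rep 0 / w.rep 1) :=
      fun P hP => eval_pderiv_homogenize _ _ hP _
    simp only [critForm, lift, Matrix.cons_val_zero, Matrix.cons_val_one, map_sub, map_mul,
      e _ (le_max_left _ _ : f.num.natDegree ≤ deg f),
      e _ (le_max_right _ _ : f.denom.natDegree ≤ deg f),
      ed _ (le_max_left _ _ : f.num.natDegree ≤ deg f),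
      ed _ (le_max_right _ _ : f.denom.natDegree ≤ deg f)] at h
    simp only [mem_ofPred_eq, Polynomial.IsRoot.def, Polynomial.wronskian, Polynomial.eval_sub,
      Polynomial.eval_mul]
    linear_combination h

/-! ### Superattracting periodic points -/

theorem mem_Fix_iff {f : RatFunc K} {n : ℕ} {w : P1 K} :
    w ∈ Fix f n ↔ Function.IsPeriodicPt (ratMap f) n w :=
  Iff.rfl

theorem finite_SAT [CharZero K] {f : RatFunc K} (hd : 0 < deg f) : (SAT f).Finite := by
  refine ((finite_Crit_one hd).biUnion (t := fun c => (fun k => (ratMap f)^[k] c) ''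
    Iio (Function.minimalPeriod (ratMap f) c)) fun c _ => (finite_Iio _).image _).subset ?_
  intro w hw
  obtain ⟨n, hfix, hcrit⟩ := mem_iUnion.1 hw
  obtain ⟨k, hk, hkc⟩ := mem_Crit_iff_exists.1 hcrit
  rw [mem_Fix_iff] at hfix
  refine mem_biUnion hkc ?_
  have hper : Function.IsPeriodicPt (ratMap f) n ((ratMap f)^[k] w) := hfix.apply_iterate k
  refine ⟨((n : ℕ) - k) % Function.minimalPeriod (ratMap f) ((ratMap f)^[k] w),
    Nat.mod_lt _ (hper.minimalPeriod_pos n.pos), ?_⟩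
  change (ratMap f)^[_ % _] _ = w
  rw [Function.iterate_mod_minimalPeriod_eq, ← Function.iterate_add_apply,
    Nat.sub_add_cancel hk.le]
  exact hfix

theorem mem_Crit_of_mem_SAT {f : RatFunc K} {n : ℕ} (hn : 0 < n) {w : P1 K} (hw : w ∈ SAT f)
    (hfix : w ∈ Fix f n) : w ∈ Crit f n := by
  obtain ⟨m, -, hcrit⟩ := mem_iUnion.1 hw
  obtain ⟨k, -, hk⟩ := mem_Crit_iff_exists.1 hcrit
  refine mem_Crit_iff_exists.2 ⟨k % n, Nat.mod_lt _ hn, ?_⟩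
  rwa [(mem_Fix_iff.1 hfix).iterate_mod_apply]

/-- A superattracting fixed point of `fⁿ` is a simple root of `fⁿ = Id`. -/
theorem fixMult_le_one {f : RatFunc K} {n : ℕ} {w : P1 K} (hfix : w ∈ Fix f n)
    (hcrit : w ∈ Crit f n) : fixMult f n w ≤ 1 := by
  set p := w.rep with hp
  obtain ⟨t, ht⟩ : ∃ t : K, t • p = iterVal f n p := by
    have h : (ratMap f)^[n] w = w := hfix
    rw [← w.mk_rep, ratMap_iterate_mk, Projectivization.mk_eq_mk_iff'] at h
    exact h
  have h0 : MvPolynomial.eval p (liftIter f n 0) = t * p 0 := (congrFun ht 0).symm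
  have h1 : MvPolynomial.eval p (liftIter f n 1) = t * p 1 := (congrFun ht 1).symm
  have ht0 : t ≠ 0 := by
    rintro rfl
    exact iterVal_ne_zero f n w.rep_nonzero (by rw [← ht, zero_smul])
  by_contra! hlt
  obtain ⟨G, hG⟩ := pow_dvd_of_le_emultiplicity (k := 2) (Order.add_one_le_of_lt hlt)
  have hG' : MvPolynomial.X 0 * liftIter f n 1 - MvPolynomial.X 1 * liftIter f n 0 =
      lineForm w ^ 2 * G := hG
  have hder : ∀ i, MvPolynomial.eval p (MvPolynomial.pderiv i
      (MvPolynomial.X 0 * liftIter f n 1 - MvPolynomial.X 1 * liftIter f n 0)) = 0 := by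
    intro i
    rw [hG', MvPolynomial.pderiv_mul, MvPolynomial.pderiv_pow]
    simp [hp, eval_lineForm_self]
  have hc : ∀ i, p 0 * MvPolynomial.eval p (MvPolynomial.pderiv i (liftIter f n 1)) -
      p 1 * MvPolynomial.eval p (MvPolynomial.pderiv i (liftIter f n 0)) = 0 := by
    intro i
    have := mem_Crit_iff.1 hcrit i
    simp only [critForm, map_sub, map_mul, ← hp, h0, h1] at this
    refine mul_left_cancel₀ ht0 ?_
    linear_combination -this
  refine w.rep_nonzero (funext fun i => ?_)
  have d0 := hder 0
  have d1 := hder 1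
  simp only [map_sub, MvPolynomial.pderiv_mul, MvPolynomial.pderiv_X, map_add, map_mul, h0, h1,
    MvPolynomial.eval_X] at d0 d1
  simp only [ne_eq, zero_ne_one, one_ne_zero, not_false_eq_true, Pi.single_eq_same,
    Pi.single_eq_of_ne, map_one, map_zero, one_mul, zero_mul] at d0 d1
  fin_cases i
  · refine mul_left_cancel₀ ht0 ?_
    simp only [Fin.zero_eta, Pi.zero_apply, mul_zero, ← hp]
    linear_combination hc 1 - d1
  · refine mul_left_cancel₀ ht0 ?_
    simp only [Fin.mk_one, Pi.zero_apply, mul_zero, ← hp]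
    linear_combination d0 - hc 0

theorem fixMeasure_image_SAT_le [CharZero K] {f : RatFunc K} (hd : 0 < deg f) {n : ℕ}
    (hn : 0 < n) : fixMeasure f n (toBerk '' SAT f) ≤ (SAT f).encard := by
  have hmeas : MeasurableSet (toBerk '' SAT f) := ((finite_SAT hd).image _).measurableSet
  rw [fixMeasure, Measure.sum_apply _ hmeas]
  calc ∑' w : Fix f n, ((fixMult f n w : ℝ≥0∞) • Measure.dirac (toBerk (w : P1 K)))
          (toBerk '' SAT f)
      ≤ ∑' w : Fix f n, (SAT f).indicator 1 (w : P1 K) := by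
        refine ENNReal.tsum_le_tsum fun w => ?_
        rw [Measure.smul_apply, Measure.dirac_apply' _ hmeas, smul_eq_mul]
        by_cases hw : (w : P1 K) ∈ SAT f
        · have h1 := fixMult_le_one w.2 (mem_Crit_of_mem_SAT hn hw w.2)
          rw [indicator_of_mem (mem_image_of_mem _ hw), indicator_of_mem hw]
          simpa using (ENat.toENNReal_le.2 h1)
        · rw [indicator_of_notMem (toBerk_injective.mem_set_image.not.2 hw), mul_zero]
          exact zero_le
    _ ≤ ∑' w : P1 K, (SAT f).indicator 1 w :=
        ENNReal.tsum_comp_le_tsum_of_injective Subtype.val_injective _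
    _ = (SAT f).encard := by
        rw [← tsum_subtype (SAT f) 1]
        exact ENNReal.tsum_set_one _

/-! ### The integral over the superattracting points -/

theorem satSep_le_one (f : RatFunc K) : satSep f ≤ 1 := inf_le_left

theorem satSep_le_chordal {f : RatFunc K} {c c' : P1 K} (hc : c ∈ SAT f) (hc' : c' ∈ SAT f)
    (hne : c ≠ c') : satSep f ≤ ENNReal.ofReal (chordal c c') :=
  inf_le_right.trans <| (iInf₂_le c hc).trans <| (iInf₂_le c' hc').trans (iInf_le _ hne)

theorem satSep_pos [CharZero K] {f : RatFunc K} (hd : 0 < deg f) : 0 < satSep f := by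
  set T : Finset (P1 K × P1 K) :=
    (((finite_SAT hd).prod (finite_SAT hd)).inter_of_left {q | q.1 ≠ q.2}).toFinset with hT
  have hmem : ∀ q, q ∈ T ↔ (q.1 ∈ SAT f ∧ q.2 ∈ SAT f) ∧ q.1 ≠ q.2 := by
    intro q
    rw [hT, Finite.mem_toFinset]
    exact Iff.rfl
  clear_value T
  have hinf : 0 < T.inf fun q => ENNReal.ofReal (chordal q.1 q.2) := by
    refine (Finset.lt_inf_iff ENNReal.zero_lt_top).2 fun q hq => ?_
    exact ENNReal.ofReal_pos.2 (chordal_pos ((hmem q).1 hq).2)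
  refine lt_inf_iff.2 ⟨one_pos, hinf.trans_le ?_⟩
  refine le_iInf₂ fun c hc => le_iInf₂ fun c' hc' => le_iInf fun hne => ?_
  exact Finset.inf_le (f := fun q : P1 K × P1 K => ENNReal.ofReal (chordal q.1 q.2))
    ((hmem (c, c')).2 ⟨⟨hc, hc'⟩, hne⟩)

theorem abs_coe_sub_coe_le {a b M : ℝ≥0∞} (hM : M ≠ ⊤) (ha : a ≤ M) (hb : b ≤ M) :
    ((a : EReal) - (b : EReal)).abs ≤ M := by
  lift M to NNReal using hM
  lift a to NNReal using (ha.trans_lt ENNReal.coe_lt_top).ne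
  lift b to NNReal using (hb.trans_lt ENNReal.coe_lt_top).ne
  have ha' : (a : ℝ) ≤ M := by exact_mod_cast ha
  have hb' : (b : ℝ) ≤ M := by exact_mod_cast hb
  have h : (((a : ℝ≥0∞) : EReal) - ((b : ℝ≥0∞) : EReal)) = (((a : ℝ) - (b : ℝ) : ℝ) : EReal) := rfl
  rw [h, EReal.abs_def, ← ENNReal.ofReal_coe_nnreal]
  refine ENNReal.ofReal_le_ofReal (abs_le.2 ⟨?_, ?_⟩)
  · linarith [NNReal.coe_nonneg a]
  · linarith [NNReal.coe_nonneg b]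

theorem abs_eintegral_restrict_le {X : Type*} [MeasurableSpace X] {ν : Measure X} {s : Set X}
    (hs : MeasurableSet s) {φ : X → EReal} {M : ℝ≥0∞} (hφ : ∀ x ∈ s, φ x ≤ M ∧ -φ x ≤ M)
    (hfin : M * ν s ≠ ⊤) : (eintegral (ν.restrict s) φ).abs ≤ M * ν s := by
  have hle : ∀ ψ : X → EReal, (∀ x ∈ s, ψ x ≤ M) →
      ∫⁻ x in s, (ψ x).toENNReal ∂ν ≤ M * ν s := by
    intro ψ hψ
    rw [← setLIntegral_const]
    refine setLIntegral_mono' hs fun x hx => ?_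
    simpa using EReal.toENNReal_le_toENNReal (hψ x hx)
  exact abs_coe_sub_coe_le hfin (hle φ fun x hx => (hφ x hx).1)
    (hle (fun x => -φ x) fun x hx => (hφ x hx).2)

/-- The uniform bound for `|Φ_{g_f}|` at pairs of distinct superattracting points. -/
def satBound (f : RatFunc K) : ℝ≥0∞ :=
  (-ENNReal.log (satSep f)).toENNReal + 2 * ⨆ S : BerkP1 K, ‖green f S‖ₑ

theorem coe_satBound (f : RatFunc K) : (satBound f : EReal) =
    -ENNReal.log (satSep f) + 2 * ((⨆ S : BerkP1 K, ‖green f S‖ₑ : ℝ≥0∞) : EReal) := by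
  rw [satBound, EReal.coe_ennreal_add, EReal.coe_ennreal_mul, EReal.coe_toENNReal]
  · rfl
  · rw [EReal.neg_nonneg, ENNReal.log_le_zero_iff]
    exact satSep_le_one f

theorem satBound_ne_top [IsAlgClosed K] [CharZero K] {f : RatFunc K} (hd : 1 < deg f) :
    satBound f ≠ ⊤ := by
  refine ENNReal.add_ne_top.2 ⟨?_, ENNReal.mul_ne_top ENNReal.ofNat_ne_top
    (iSup_enorm_green_lt_top f hd).ne⟩
  rw [EReal.toENNReal_ne_top_iff, Ne, EReal.neg_eq_top_iff, ENNReal.log_eq_bot_iff]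
  exact (satSep_pos (by omega)).ne'

theorem Phi_toBerk_le_satBound [IsAlgClosed K] [CharZero K] {f : RatFunc K} (hd : 1 < deg f)
    {c c' : P1 K} (hc : c ∈ SAT f) (hc' : c' ∈ SAT f) (hne : c ≠ c') :
    Phi (green f) (toBerk c) (toBerk c') ≤ satBound f ∧
      -Phi (green f) (toBerk c) (toBerk c') ≤ satBound f := by
  set M := ⨆ S : BerkP1 K, ‖green f S‖ₑ with hM
  have hMtop : M ≠ ⊤ := (iSup_enorm_green_lt_top f hd).ne
  have hg : ∀ S : BerkP1 K, |green f S| ≤ M.toReal := fun S => by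
    rw [← Real.norm_eq_abs, ← toReal_enorm]
    exact ENNReal.toReal_mono hMtop (le_iSup (fun S : BerkP1 K => ‖green f S‖ₑ) S)
  have hsep := satSep_pos (f := f) (by omega)
  have hsep' : satSep f ≠ ⊤ := ((satSep_le_one f).trans_lt ENNReal.one_lt_top).ne
  have hpos := chordal_pos hne
  have hlog0 : Real.log (chordal c c') ≤ 0 :=
    Real.log_nonpos hpos.le (chordal_le_one c c')
  have hseppos : 0 < (satSep f).toReal := ENNReal.toReal_pos hsep.ne' hsep'
  have hlog1 : Real.log (satSep f).toReal ≤ Real.log (chordal c c') :=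
    Real.log_le_log hseppos (ENNReal.toReal_le_of_le_ofReal hpos.le (satSep_le_chordal hc hc' hne))
  have hB : (satBound f : EReal) = ((-Real.log (satSep f).toReal + 2 * M.toReal : ℝ) : EReal) := by
    rw [coe_satBound, ← hM, ENNReal.log_pos_real hsep.ne' hsep', ← EReal.coe_ennreal_toReal hMtop]
    rfl
  have hPhi : Phi (green f) (toBerk c) (toBerk c') =
      ((Real.log (chordal c c') - green f (toBerk c) - green f (toBerk c') : ℝ) : EReal) := by
    rw [Phi, hsia_toBerk hne, ENNReal.log_ofReal_of_pos hpos]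
    rfl
  obtain ⟨h₁, h₂⟩ := abs_le.1 (hg (toBerk c))
  obtain ⟨h₃, h₄⟩ := abs_le.1 (hg (toBerk c'))
  rw [hPhi, hB, ← EReal.coe_neg, EReal.coe_le_coe_iff, EReal.coe_le_coe_iff]
  constructor <;> linarith

theorem iSup_fixMeasure_ne_top [CharZero K] {f : RatFunc K} (hd : 0 < deg f) :
    (⨆ n : ℕ+, fixMeasure f n (toBerk '' SAT f)) ≠ ⊤ := by
  refine ne_top_of_le_ne_top ?_ (iSup_le fun n : ℕ+ => fixMeasure_image_SAT_le hd n.pos)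
  simpa using (finite_SAT hd).encard_lt_top.ne

end BerkDyn

end

open BerkDyn in
theorem superattracting_fixed_integral_bounded {K : Type*} [NontriviallyNormedField K]
    [CompleteSpace K] [IsAlgClosed K] [CharZero K] (f : RatFunc K) (hd : 1 < deg f) :
    ((⨆ (n : ℕ+) (c ∈ Crit f n ∩ Fix f n),
        (eintegral ((fixMeasure f n).restrict (toBerk '' (SAT f \ {c})))
          (Phi (green f) (toBerk c))).abs : ℝ≥0∞) : EReal)
      ≤ (-ENNReal.log (satSep f) + 2 * ((⨆ S : BerkP1 K, ‖green f S‖ₑ : ℝ≥0∞) : EReal)) *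
          ((⨆ n : ℕ+, fixMeasure f n (toBerk '' SAT f) : ℝ≥0∞) : EReal) ∧
    (-ENNReal.log (satSep f) + 2 * ((⨆ S : BerkP1 K, ‖green f S‖ₑ : ℝ≥0∞) : EReal)) *
        ((⨆ n : ℕ+, fixMeasure f n (toBerk '' SAT f) : ℝ≥0∞) : EReal) < ⊤ := by
  have hd0 : 0 < deg f := by omega
  have hfin : satBound f * (⨆ n : ℕ+, fixMeasure f n (toBerk '' SAT f)) ≠ ⊤ :=
    ENNReal.mul_ne_top (satBound_ne_top hd) (iSup_fixMeasure_ne_top hd0)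
  rw [← coe_satBound, ← EReal.coe_ennreal_mul]
  refine ⟨EReal.coe_ennreal_le_coe_ennreal_iff.2 (iSup_le fun n => iSup₂_le fun c hc => ?_),
    Ne.lt_top (mt EReal.coe_ennreal_eq_top_iff.1 hfin)⟩
  have hcSAT : c ∈ SAT f := mem_iUnion.2 ⟨n, hc.2, hc.1⟩
  have hle : satBound f * fixMeasure f n (toBerk '' (SAT f \ {c})) ≤
      satBound f * ⨆ n : ℕ+, fixMeasure f n (toBerk '' SAT f) :=
    mul_le_mul_right ((measure_mono (image_mono sdiff_subset)).trans
      (le_iSup (fun n : ℕ+ => fixMeasure f n (toBerk '' SAT f)) n)) _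
  refine (abs_eintegral_restrict_le (((finite_SAT hd0).sdiff).image _).measurableSet ?_
    (ne_top_of_le_ne_top hfin hle)).trans hle
  rintro _ ⟨c', ⟨hc', hne⟩, rfl⟩
  exact Phi_toBerk_le_satBound hd hcSAT hc' (Ne.symm hne)
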